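/- arXiv:2506.21779 — 2 statements merged into one kernel-verified Lean document; each statement's English description precedes it below -/
import Mathlib

section
/- Set α₀ = 10^{−10}. For every integer k ≥ 1 there is a constant C > 0 such that for every function h : ℝ² → ℝ of class C^{k+1} for which all the norms below are finite, one has the Gagliardo–Nirenberg-type weighted interpolation inequality ‖h‖_{W^{k,4}_{−α₀+1/2}(ℝ²)} ≤ C ( ‖h‖_{H^{k}_{−α₀}(ℝ²)}^{1/3} ‖h‖_{H^{k+1}_{−α₀}(ℝ²)}^{2/3} + ‖h‖_{W^{k−1,4}_{−α₀+1/2}(ℝ²)} ). -/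
open MeasureTheory
open scoped ENNReal

noncomputable section

abbrev E2 := EuclideanSpace ℝ (Fin 2)

/-- `α₀ = 10^{−10}`. -/
def alpha0 : ℝ := 10 ^ (-(10:ℤ))

/-- Partial derivative in the `i`-th coordinate direction. -/
def pdi (i : Fin 2) (f : E2 → ℝ) : E2 → ℝ :=
  fun x => fderiv ℝ f x (EuclideanSpace.single i 1)

/-- `a`-fold iterated partial derivative in direction `i`. -/
def pdIter (i : Fin 2) : ℕ → (E2 → ℝ) → (E2 → ℝ)
  | 0, f => f
  | (a+1), f => pdi i (pdIter i a f)

/-- The multi-index derivative `∂^α = ∂₁^a ∂₂^b`. -/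
def pdMix (a b : ℕ) (f : E2 → ℝ) : E2 → ℝ := pdIter 0 a (pdIter 1 b f)

/-- One summand `‖⟨x⟩^{r+|α|} ∂^α h‖_{L^p}` of the weighted Sobolev norm, as an `ℝ≥0∞` value. -/
def wPiece (p : ℝ≥0∞) (r : ℝ) (a b : ℕ) (h : E2 → ℝ) : ℝ≥0∞ :=
  eLpNorm (fun x => (Real.sqrt (1 + ‖x‖^2)) ^ (r + a + b) * pdMix a b h x) p volume

/-- The weighted Sobolev norm `‖h‖_{W^{k,p}_r} = ∑_{|α| ≤ k} ‖⟨x⟩^{r+|α|} ∂^α h‖_{L^p}`. -/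
def wNorm (p : ℝ≥0∞) (r : ℝ) (k : ℕ) (h : E2 → ℝ) : ℝ :=
  ∑ a ∈ Finset.range (k+1), ∑ b ∈ Finset.range (k+1-a), (wPiece p r a b h).toReal

/-- Finiteness of all the constituents of the weighted Sobolev norm `W^{k,p}_r`. -/
def wFin (p : ℝ≥0∞) (r : ℝ) (k : ℕ) (h : E2 → ℝ) : Prop :=
  ∀ a b : ℕ, a + b ≤ k → wPiece p r a b h ≠ ⊤

/-- The Japanese bracket `⟨x⟩ = (1 + |x|²)^{1/2}`. -/
def bracket (x : E2) : ℝ := Real.sqrt (1 + ‖x‖ ^ 2)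

lemma one_le_bracket (x : E2) : 1 ≤ bracket x := by
  rw [bracket, Real.one_le_sqrt]; nlinarith [sq_nonneg ‖x‖]

lemma bracket_pos (x : E2) : 0 < bracket x := one_pos.trans_le (one_le_bracket x)

lemma norm_le_bracket (x : E2) : ‖x‖ ≤ bracket x :=
  Real.le_sqrt_of_sq_le (by linarith)

lemma bracket_le_one_add_norm (x : E2) : bracket x ≤ 1 + ‖x‖ :=
  Real.sqrt_le_iff.2 ⟨by positivity, by nlinarith [norm_nonneg x]⟩

lemma contDiff_bracket : ContDiff ℝ 1 bracket :=
  (contDiff_const.add (contDiff_norm_sq ℝ)).sqrt fun x => by positivity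

lemma norm_fderiv_bracket_le (x : E2) : ‖fderiv ℝ bracket x‖ ≤ 1 := by
  have h := ((hasStrictFDerivAt_norm_sq x).hasFDerivAt.const_add 1).sqrt
    (by positivity : (1 + ‖x‖ ^ 2) ≠ 0)
  have h' : HasFDerivAt bracket _ x := h
  have hb := bracket_pos x
  have e : fderiv ℝ bracket x = (bracket x)⁻¹ • innerSL ℝ x := by
    rw [h'.fderiv, ← bracket, ← Nat.cast_smul_eq_nsmul ℝ 2, smul_smul]
    congr 1
    push_cast
    field_simp
  rw [e, norm_smul, innerSL_apply_norm, norm_inv, Real.norm_eq_abs, abs_of_pos hb,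
    inv_mul_le_iff₀ hb, mul_one]
  exact norm_le_bracket x

lemma contDiff_bracket_rpow (t : ℝ) : ContDiff ℝ 1 fun x => bracket x ^ t :=
  contDiff_bracket.rpow_const_of_ne fun x => (bracket_pos x).ne'

lemma norm_fderiv_bracket_rpow_le (t : ℝ) (x : E2) :
    ‖fderiv ℝ (fun y => bracket y ^ t) x‖ ≤ |t| * bracket x ^ (t - 1) := by
  have h := ((contDiff_bracket.differentiable one_ne_zero x).hasFDerivAt).rpow_const (p := t)
    (Or.inl (bracket_pos x).ne')
  have := Real.rpow_nonneg (bracket_pos x).le (t - 1)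
  rw [h.fderiv, norm_smul, norm_mul, Real.norm_eq_abs, Real.norm_eq_abs, abs_of_nonneg this]
  exact mul_le_of_le_one_right (by positivity) (norm_fderiv_bracket_le x)

lemma norm_fderiv_le_pdi (u : E2 → ℝ) (x : E2) :
    ‖fderiv ℝ u x‖ ≤ |pdi 0 u x| + |pdi 1 u x| := by
  refine ContinuousLinearMap.opNorm_le_bound _ (by positivity) fun v => ?_
  have hv : v = v 0 • EuclideanSpace.single 0 (1 : ℝ) + v 1 • EuclideanSpace.single 1 (1 : ℝ) := by
    ext i; fin_cases i <;> simp
  conv_lhs => rw [hv]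
  rw [map_add, map_smul, map_smul, add_mul]
  refine (norm_add_le _ _).trans ?_
  simp only [norm_smul, pdi, Real.norm_eq_abs]
  have h0 : |v 0| ≤ ‖v‖ := PiLp.norm_apply_le v 0
  have h1 : |v 1| ≤ ‖v‖ := PiLp.norm_apply_le v 1
  rw [mul_comm |v 0|, mul_comm |v 1|]
  gcongr

lemma exists_bump : ∃ f : E2 → ℝ, ContDiff ℝ 1 f ∧ HasCompactSupport f ∧
    (∀ x, 0 ≤ f x ∧ f x ≤ 1) ∧ ∀ x, ‖x‖ ≤ 1 → f x = 1 := by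
  let f : ContDiffBump (0 : E2) := ⟨1, 2, one_pos, one_lt_two⟩
  exact ⟨f, f.contDiff, f.hasCompactSupport, fun x => ⟨f.nonneg, f.le_one⟩,
    fun x hx => f.one_of_mem_closedBall (mem_closedBall_zero_iff.2 hx)⟩

lemma fderiv_comp_smul_eq {f : E2 → ℝ} (hf : ContDiff ℝ 1 f) (c : ℝ) (x : E2) :
    fderiv ℝ (fun x => f (c • x)) x = c • fderiv ℝ f (c • x) := by
  have hd := (hf.differentiable one_ne_zero (c • x)).hasFDerivAt.comp x
    ((hasFDerivAt_id x).const_smul c)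
  have hd' : HasFDerivAt (fun x => f (c • x)) _ x := hd
  rw [hd'.fderiv, ContinuousLinearMap.comp_smul, ContinuousLinearMap.comp_id]

lemma exists_weighted_fderiv_bound {f : E2 → ℝ} (hf : ContDiff ℝ 1 f) (hfc : HasCompactSupport f) :
    ∃ M : ℝ, 0 ≤ M ∧ ∀ y, (1 + ‖y‖) * ‖fderiv ℝ f y‖ ≤ M := by
  have hd : Continuous (fderiv ℝ f) := hf.continuous_fderiv one_ne_zero
  have hcont : Continuous fun y : E2 => (1 + ‖y‖) * ‖fderiv ℝ f y‖ :=
    (continuous_const.add continuous_norm).mul hd.norm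
  have hsupp : HasCompactSupport fun y : E2 => (1 + ‖y‖) * ‖fderiv ℝ f y‖ :=
    HasCompactSupport.mul_left (hfc.fderiv ℝ).norm
  obtain ⟨M, hM⟩ := hcont.bounded_above_of_compact_support hsupp
  exact ⟨M, (norm_nonneg _).trans (hM 0), fun y => (le_abs_self _).trans (hM y)⟩

lemma norm_fderiv_comp_smul_le {f : E2 → ℝ} (hf : ContDiff ℝ 1 f) {M : ℝ}
    (hM : ∀ y, (1 + ‖y‖) * ‖fderiv ℝ f y‖ ≤ M) {c : ℝ} (hc0 : 0 ≤ c) (hc1 : c ≤ 1) (x : E2) :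
    ‖fderiv ℝ (fun x => f (c • x)) x‖ ≤ M / bracket x := by
  rw [fderiv_comp_smul_eq hf, norm_smul, le_div_iff₀ (bracket_pos x), Real.norm_eq_abs,
    abs_of_nonneg hc0]
  refine le_trans ?_ (hM (c • x))
  rw [mul_right_comm, norm_smul, Real.norm_eq_abs, abs_of_nonneg hc0]
  gcongr
  calc c * bracket x ≤ c * (1 + ‖x‖) := by gcongr; exact bracket_le_one_add_norm x
    _ = c + c * ‖x‖ := by ring
    _ ≤ 1 + c * ‖x‖ := by gcongr

/-- Smooth compactly supported cutoffs tending to `1`, whose gradients are bounded by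
`M / ⟨x⟩` uniformly. -/
lemma exists_cutoff : ∃ (M : ℝ) (χ : ℕ → E2 → ℝ), 0 ≤ M ∧ (∀ n, ContDiff ℝ 1 (χ n)) ∧
    (∀ n, HasCompactSupport (χ n)) ∧ (∀ n x, 0 ≤ χ n x ∧ χ n x ≤ 1) ∧
    (∀ n x, ‖fderiv ℝ (χ n) x‖ ≤ M / bracket x) ∧
    ∀ x, Filter.Tendsto (fun n => χ n x) Filter.atTop (nhds 1) := by
  obtain ⟨f, hf, hfc, hf01, hf1⟩ := exists_bump
  obtain ⟨M, hM0, hM⟩ := exists_weighted_fderiv_bound hf hfc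
  have hpos : ∀ n : ℕ, (0 : ℝ) < n + 1 := fun n => by positivity
  refine ⟨M, fun n x => f ((n + 1 : ℝ)⁻¹ • x), hM0, fun n => ?_, fun n => ?_, fun n x => hf01 _,
    fun n x => ?_, fun x => ?_⟩
  · exact hf.comp (contDiff_id.const_smul _)
  · exact hfc.comp_smul (inv_ne_zero (hpos n).ne')
  · exact norm_fderiv_comp_smul_le hf hM (inv_nonneg.2 (hpos n).le)
      (inv_le_one_of_one_le₀ (by linarith [n.cast_nonneg (α := ℝ)])) x
  · refine tendsto_const_nhds.congr' ?_
    obtain ⟨N, hN⟩ := exists_nat_ge ‖x‖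
    filter_upwards [Filter.eventually_ge_atTop N] with n hn
    refine (hf1 _ ?_).symm
    have hn' : (N : ℝ) ≤ n := by exact_mod_cast hn
    rw [norm_smul, norm_inv, Real.norm_eq_abs,
      abs_of_pos (hpos n), inv_mul_le_iff₀ (hpos n)]
    linarith

lemma pdi_comm {f : E2 → ℝ} (hf : ContDiff ℝ 2 f) : pdi 1 (pdi 0 f) = pdi 0 (pdi 1 f) := by
  funext x
  have hd : DifferentiableAt ℝ (fderiv ℝ f) x :=
    (hf.fderiv_right (m := 1) (by norm_num)).differentiable one_ne_zero x
  have key : ∀ i j : Fin 2, pdi i (pdi j f) x =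
      fderiv ℝ (fderiv ℝ f) x (EuclideanSpace.single i 1) (EuclideanSpace.single j 1) := by
    intro i j
    have := (hd.hasFDerivAt.clm_apply (hasFDerivAt_const (EuclideanSpace.single j (1 : ℝ)) x))
    have h' : HasFDerivAt (pdi j f) _ x := this
    rw [pdi, h'.fderiv]
    simp
  rw [key, key]
  exact (hf.contDiffAt.isSymmSndFDerivAt (by simp)) _ _

lemma contDiff_pdi (i : Fin 2) {m : ℕ} {f : E2 → ℝ} (hf : ContDiff ℝ (m + 1 : ℕ) f) :
    ContDiff ℝ m (pdi i f) :=
  (hf.fderiv_right (m := m) (by norm_cast)).clm_apply contDiff_const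

lemma contDiff_pdIter (i : Fin 2) (a : ℕ) {m : ℕ} {f : E2 → ℝ}
    (hf : ContDiff ℝ (m + a : ℕ) f) : ContDiff ℝ m (pdIter i a f) := by
  induction a generalizing m with
  | zero => exact hf
  | succ a ih => exact contDiff_pdi i (ih (by convert hf using 2; ring))

lemma pdi_one_pdIter_zero (a : ℕ) {f : E2 → ℝ} (hf : ContDiff ℝ (a + 1 : ℕ) f) :
    pdi 1 (pdIter 0 a f) = pdIter 0 a (pdi 1 f) := by
  induction a with
  | zero => rfl
  | succ a ih =>
    have h2 : ContDiff ℝ (2 : ℕ) (pdIter 0 a f) :=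
      contDiff_pdIter 0 a (by convert hf using 2; ring)
    rw [pdIter, pdi_comm h2, ih (hf.of_le (by norm_cast; omega)), pdIter]

lemma rpow_two_mul_mul_sq {J : ℝ} (hJ : 0 < J) (s y : ℝ) : J ^ (2 * s) * y ^ 2 = (J ^ s * y) ^ 2 := by
  rw [two_mul, Real.rpow_add hJ]; ring

/-- Pointwise gradient bound for a cutoff times `⟨x⟩^{2s+1} u²`. -/
lemma norm_fderiv_cutoff_mul_le {u χ : E2 → ℝ} (hu : ContDiff ℝ 1 u) (hχ : ContDiff ℝ 1 χ)
    {M : ℝ} (s : ℝ) (x : E2) (h01 : 0 ≤ χ x ∧ χ x ≤ 1)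
    (hM : ‖fderiv ℝ χ x‖ ≤ M / bracket x) :
    ‖fderiv ℝ (fun y => χ y * (bracket y ^ (2 * s + 1) * u y ^ 2)) x‖ ≤
      (M + |2 * s + 1|) * (|bracket x ^ s * u x| * |bracket x ^ s * u x|) +
      2 * (|bracket x ^ s * u x| * |bracket x ^ (s + 1) * pdi 0 u x|) +
      2 * (|bracket x ^ s * u x| * |bracket x ^ (s + 1) * pdi 1 u x|) := by
  have hJ := bracket_pos x
  have hdu := (hu.differentiable one_ne_zero x).hasFDerivAt
  have hdJ := ((contDiff_bracket_rpow (2 * s + 1)).differentiable one_ne_zero x).hasFDerivAt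
  have hdχ := (hχ.differentiable one_ne_zero x).hasFDerivAt
  have hd := hdχ.mul (hdJ.mul (hdu.pow 2))
  have hd' : HasFDerivAt (fun y => χ y * (bracket y ^ (2 * s + 1) * u y ^ 2)) _ x := hd
  have bJ := norm_fderiv_bracket_rpow_le (2 * s + 1) x
  rw [add_sub_cancel_right] at bJ
  have bu := norm_fderiv_le_pdi u x
  have p1 : bracket x ^ (2 * s + 1) = bracket x ^ s * bracket x ^ (s + 1) := by
    rw [← Real.rpow_add hJ]; congr 1; ring
  have p2 : bracket x ^ (s + 1) = bracket x ^ s * bracket x := Real.rpow_add_one hJ.ne' s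
  have p3 : bracket x ^ (2 * s) = bracket x ^ s * bracket x ^ s := by
    rw [← Real.rpow_add hJ]; congr 1; ring
  rw [hd'.fderiv]
  rw [p3] at bJ
  have hs : 0 < bracket x ^ s := Real.rpow_pos_of_pos hJ s
  have hs1 : 0 < bracket x ^ (s + 1) := Real.rpow_pos_of_pos hJ _
  simp only [abs_mul, abs_of_pos hs, abs_of_pos hs1]
  set P := bracket x ^ s
  refine (norm_add_le _ _).trans ?_
  rw [norm_smul, norm_smul]
  have e1 : ‖bracket x ^ (2 * s + 1) * u x ^ 2‖ * ‖fderiv ℝ χ x‖ ≤ M * (P * |u x| * (P * |u x|)) := by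
    rw [p1, p2, Real.norm_eq_abs, abs_of_nonneg (by positivity)]
    calc P * (P * bracket x) * u x ^ 2 * ‖fderiv ℝ χ x‖
        ≤ P * (P * bracket x) * u x ^ 2 * (M / bracket x) := by gcongr
      _ = M * (P * |u x| * (P * |u x|)) := by
        rw [← sq_abs (u x)]; field_simp
  have e2 : ∀ L : E2 →L[ℝ] ℝ, ‖χ x‖ * ‖L‖ ≤ ‖L‖ := fun L => by
    rw [Real.norm_eq_abs, abs_of_nonneg h01.1]
    exact mul_le_of_le_one_left (norm_nonneg _) h01.2
  have e3 : ‖bracket x ^ (2 * s + 1) • ((2 : ℕ) • u x ^ (2 - 1)) • fderiv ℝ u x +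
      u x ^ 2 • fderiv ℝ (fun y => bracket y ^ (2 * s + 1)) x‖ ≤
      P * bracket x ^ (s + 1) * (2 * |u x| * (|pdi 0 u x| + |pdi 1 u x|)) +
        |u x| ^ 2 * (|2 * s + 1| * (P * P)) := by
    refine (norm_add_le _ _).trans ?_
    rw [norm_smul, norm_smul _ (fderiv ℝ u x), norm_smul (u x ^ 2), p1]
    simp only [Real.norm_eq_abs, abs_mul, abs_pow, abs_of_pos hs, abs_of_pos hs1, nsmul_eq_mul,
      Nat.cast_ofNat, abs_two, Nat.add_one_sub_one, pow_one]
    gcongr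
  refine (add_le_add ((e2 _).trans e3) e1).trans (le_of_eq ?_)
  ring

/-- Weighted two-dimensional Ladyzhenskaya inequality. -/
lemma exists_ladyzhenskaya (s : ℝ) : ∃ C : ℝ≥0∞, C ≠ ⊤ ∧ ∀ u : E2 → ℝ, ContDiff ℝ 1 u →
    eLpNorm (fun x => bracket x ^ (s + 1 / 2) * u x) 4 volume ^ 2 ≤
      C * (eLpNorm (fun x => bracket x ^ s * u x) 2 volume *
        (eLpNorm (fun x => bracket x ^ s * u x) 2 volume +
          eLpNorm (fun x => bracket x ^ (s + 1) * pdi 0 u x) 2 volume +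
          eLpNorm (fun x => bracket x ^ (s + 1) * pdi 1 u x) 2 volume)) := by
  obtain ⟨M, χ, hM0, hχ, hχc, h01, hχM, hlim⟩ := exists_cutoff
  let K : ℝ≥0∞ := eLpNormLESNormFDerivOneConst (volume : Measure E2) ((2 : NNReal) : ℝ)
  let D : ℝ≥0∞ := ENNReal.ofReal (M + |2 * s + 1|) + 2
  refine ⟨K * D, ENNReal.mul_ne_top ENNReal.coe_ne_top
    (ENNReal.add_ne_top.2 ⟨ENNReal.ofReal_ne_top, by simp⟩), fun u hu => ?_⟩
  have hcu : ∀ t : ℝ, Continuous fun x => bracket x ^ t * u x := fun t =>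
    (contDiff_bracket_rpow t).continuous.mul hu.continuous
  have hcd : ∀ (i : Fin 2) (t : ℝ), Continuous fun x => bracket x ^ t * pdi i u x := fun i t =>
    (contDiff_bracket_rpow t).continuous.mul
      ((hu.continuous_fderiv one_ne_zero).clm_apply continuous_const)
  set f := fun x => bracket x ^ s * u x
  set g := fun (i : Fin 2) x => bracket x ^ (s + 1) * pdi i u x
  have hsq : eLpNorm (fun x => bracket x ^ (s + 1 / 2) * u x) 4 volume ^ 2 =
      eLpNorm (fun x => bracket x ^ (2 * s + 1) * u x ^ 2) 2 volume := by
    have h := eLpNorm_norm_rpow (μ := volume) (p := 2) (q := 2)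
      (fun x => bracket x ^ (s + 1 / 2) * u x) two_pos
    have h4 : (2 : ℝ≥0∞) * ENNReal.ofReal 2 = 4 := by
      rw [ENNReal.ofReal_ofNat]; norm_num
    rw [h4, ENNReal.rpow_two] at h
    rw [← h]
    congr 1
    funext x
    rw [Real.rpow_two, Real.norm_eq_abs, sq_abs, ← rpow_two_mul_mul_sq (bracket_pos x)]
    congr 2
    ring
  have hholder : ∀ v : E2 → ℝ, Continuous v →
      ∫⁻ x, ‖f x‖ₑ * ‖v x‖ₑ ≤ eLpNorm f 2 volume * eLpNorm v 2 volume := by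
    intro v hv
    have := eLpNorm_smul_le_mul_eLpNorm (p := 2) (q := 2) (r := 1) (μ := volume)
      hv.aestronglyMeasurable (hcu s).aestronglyMeasurable
    rw [eLpNorm_one_eq_lintegral_enorm] at this
    refine le_of_eq_of_le (lintegral_congr fun x => ?_) this
    exact (enorm_mul (f x) (v x)).symm
  have hbound : ∀ n, eLpNorm (fun x => χ n x * (bracket x ^ (2 * s + 1) * u x ^ 2)) 2 volume ≤
      K * D * (eLpNorm f 2 volume *
        (eLpNorm f 2 volume + eLpNorm (g 0) 2 volume + eLpNorm (g 1) 2 volume)) := by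
    intro n
    have hw : ContDiff ℝ 1 fun x => χ n x * (bracket x ^ (2 * s + 1) * u x ^ 2) :=
      (hχ n).mul ((contDiff_bracket_rpow _).mul (hu.pow 2))
    have hwc : HasCompactSupport fun x => χ n x * (bracket x ^ (2 * s + 1) * u x ^ 2) :=
      (hχc n).mul_right
    have hp : NNReal.HolderConjugate (Module.finrank ℝ E2 : NNReal) 2 := by
      rw [finrank_euclideanSpace_fin]
      exact NNReal.HolderConjugate.two_two
    refine (eLpNorm_le_eLpNorm_fderiv_one (μ := volume) hw hwc hp).trans ?_
    rw [mul_assoc]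
    refine mul_le_mul_right ?_ K
    rw [eLpNorm_one_eq_lintegral_enorm]
    have hm : ∀ v : E2 → ℝ, Continuous v → Measurable fun x => ‖f x‖ₑ * ‖v x‖ₑ := fun v hv =>
      ((hcu s).enorm.measurable).mul hv.enorm.measurable
    calc ∫⁻ x, ‖fderiv ℝ (fun x => χ n x * (bracket x ^ (2 * s + 1) * u x ^ 2)) x‖ₑ
        ≤ ∫⁻ x, (ENNReal.ofReal (M + |2 * s + 1|) * (‖f x‖ₑ * ‖f x‖ₑ) +
            2 * (‖f x‖ₑ * ‖g 0 x‖ₑ) + 2 * (‖f x‖ₑ * ‖g 1 x‖ₑ)) := by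
          refine lintegral_mono fun x => ?_
          have h := norm_fderiv_cutoff_mul_le hu (hχ n) s x (h01 n x) (hχM n x)
          have h' := ENNReal.ofReal_le_ofReal h
          rw [ofReal_norm] at h'
          refine h'.trans (le_of_eq ?_)
          have hc : 0 ≤ M + |2 * s + 1| := by positivity
          rw [ENNReal.ofReal_add (by positivity) (by positivity),
            ENNReal.ofReal_add (by positivity) (by positivity)]
          simp only [ENNReal.ofReal_mul hc, ENNReal.ofReal_mul zero_le_two,
            ENNReal.ofReal_mul (abs_nonneg _), ENNReal.ofReal_ofNat, ← Real.enorm_eq_ofReal_abs]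
          rfl
      _ = ENNReal.ofReal (M + |2 * s + 1|) * (∫⁻ x, ‖f x‖ₑ * ‖f x‖ₑ) +
            2 * (∫⁻ x, ‖f x‖ₑ * ‖g 0 x‖ₑ) + 2 * (∫⁻ x, ‖f x‖ₑ * ‖g 1 x‖ₑ) := by
          rw [lintegral_add_right _ ((hm _ (hcd 1 _)).const_mul _),
            lintegral_add_right _ ((hm _ (hcd 0 _)).const_mul _),
            lintegral_const_mul _ (hm _ (hcu s)), lintegral_const_mul _ (hm _ (hcd 0 _)),
            lintegral_const_mul _ (hm _ (hcd 1 _))]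
      _ ≤ D * (eLpNorm f 2 volume * eLpNorm f 2 volume) +
            D * (eLpNorm f 2 volume * eLpNorm (g 0) 2 volume) +
            D * (eLpNorm f 2 volume * eLpNorm (g 1) 2 volume) := by
          gcongr
          · exact le_self_add
          · exact hholder _ (hcu s)
          · exact le_add_self
          · exact hholder _ (hcd 0 _)
          · exact le_add_self
          · exact hholder _ (hcd 1 _)
      _ = _ := by ring
  rw [hsq]
  refine (Lp.eLpNorm_lim_le_liminf_eLpNorm
    (f := fun n x => χ n x * (bracket x ^ (2 * s + 1) * u x ^ 2)) (fun n => ?_) _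
    (.of_forall fun x => ?_)).trans ?_
  · exact ((hχ n).continuous.mul ((contDiff_bracket_rpow _).continuous.mul
      (hu.continuous.pow 2))).aestronglyMeasurable
  · simpa using (hlim x).mul_const (bracket x ^ (2 * s + 1) * u x ^ 2)
  · refine Filter.liminf_le_of_le (by isBoundedDefault) fun b hb => ?_
    obtain ⟨n, hn⟩ := hb.exists
    exact hn.trans (hbound n)

lemma wPiece_toReal_le_wNorm (p : ℝ≥0∞) (r : ℝ) {k a b : ℕ} (hab : a + b ≤ k) (h : E2 → ℝ) :
    (wPiece p r a b h).toReal ≤ wNorm p r k h := by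
  refine le_trans ?_ (Finset.single_le_sum
    (f := fun a => ∑ b ∈ Finset.range (k + 1 - a), (wPiece p r a b h).toReal)
    (fun _ _ => Finset.sum_nonneg fun _ _ => ENNReal.toReal_nonneg)
    (Finset.mem_range.2 (by omega : a < k + 1)))
  exact Finset.single_le_sum (f := fun b => (wPiece p r a b h).toReal)
    (fun _ _ => ENNReal.toReal_nonneg) (Finset.mem_range.2 (by omega : b < k + 1 - a))

lemma wNorm_nonneg (p : ℝ≥0∞) (r : ℝ) (k : ℕ) (h : E2 → ℝ) : 0 ≤ wNorm p r k h :=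
  Finset.sum_nonneg fun _ _ => Finset.sum_nonneg fun _ _ => ENNReal.toReal_nonneg

lemma wNorm_mono (p : ℝ≥0∞) (r : ℝ) {k l : ℕ} (hkl : k ≤ l) (h : E2 → ℝ) :
    wNorm p r k h ≤ wNorm p r l h := by
  refine (Finset.sum_le_sum fun a _ => ?_).trans (Finset.sum_le_sum_of_subset_of_nonneg
    (Finset.range_mono (by omega : k + 1 ≤ l + 1))
    fun _ _ _ => Finset.sum_nonneg fun _ _ => ENNReal.toReal_nonneg)
  exact Finset.sum_le_sum_of_subset_of_nonneg (Finset.range_mono (by omega))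
    fun _ _ _ => ENNReal.toReal_nonneg

lemma wNorm_le_of_wPiece_le {p : ℝ≥0∞} {r : ℝ} {k : ℕ} {h : E2 → ℝ} {Q : ℝ} (hQ : 0 ≤ Q)
    (hle : ∀ a b, a + b ≤ k → (wPiece p r a b h).toReal ≤ Q) :
    wNorm p r k h ≤ (k + 1) * ((k + 1) * Q) := by
  have h1 : ∀ a ∈ Finset.range (k + 1),
      ∑ b ∈ Finset.range (k + 1 - a), (wPiece p r a b h).toReal ≤ (k + 1) * Q := by
    intro a ha
    rw [Finset.mem_range] at ha
    refine (Finset.sum_le_card_nsmul _ _ Q fun b hb => hle a b ?_).trans ?_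
    · rw [Finset.mem_range] at hb; omega
    · rw [Finset.card_range, nsmul_eq_mul]
      gcongr
      exact_mod_cast Nat.sub_le _ _
  simpa [wNorm] using Finset.sum_le_card_nsmul _ _ _ h1

lemma le_of_sq_le_mul {T A B C : ℝ} (hA : 0 ≤ A) (hAB : A ≤ B) (hC : 0 ≤ C)
    (h : T ^ 2 ≤ C * (A * B)) :
    T ≤ Real.sqrt C * (A ^ ((1 : ℝ) / 3) * B ^ ((2 : ℝ) / 3)) := by
  have hB := hA.trans hAB
  have cube : ∀ {x : ℝ}, 0 ≤ x → x = (x ^ ((1 : ℝ) / 3)) ^ 3 := fun {x} hx => by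
    rw [← Real.rpow_natCast, ← Real.rpow_mul hx]; norm_num
  have hB2 : B ^ ((2 : ℝ) / 3) = (B ^ ((1 : ℝ) / 3)) ^ 2 := by
    rw [← Real.rpow_natCast, ← Real.rpow_mul hB]; norm_num
  have hXY : A ^ ((1 : ℝ) / 3) ≤ B ^ ((1 : ℝ) / 3) := Real.rpow_le_rpow hA hAB (by norm_num)
  have hX : 0 ≤ A ^ ((1 : ℝ) / 3) := Real.rpow_nonneg hA _
  rw [hB2]
  refine le_of_sq_le_sq ?_ (by positivity)
  rw [mul_pow, Real.sq_sqrt hC]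
  refine h.trans (mul_le_mul_of_nonneg_left ?_ hC)
  have a := cube hA
  have b := cube hB
  generalize A ^ ((1 : ℝ) / 3) = X at hX hXY a ⊢
  generalize B ^ ((1 : ℝ) / 3) = Y at hXY b ⊢
  have hY := hX.trans hXY
  rw [a, b]
  nlinarith [mul_le_mul_of_nonneg_left hXY (by positivity : 0 ≤ X ^ 2 * Y ^ 3)]

lemma pdi_one_pdMix {a b : ℕ} {h : E2 → ℝ} (hh : ContDiff ℝ (a + b + 1 : ℕ) h) :
    pdi 1 (pdMix a b h) = pdMix a (b + 1) h :=
  pdi_one_pdIter_zero a (contDiff_pdIter 1 b (by convert hh using 2; ring))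

/-- The weighted Ladyzhenskaya inequality applied to a derivative of order `a + b`. -/
lemma wPiece_sq_le {r : ℝ} {a b : ℕ} {C : ℝ≥0∞}
    (hlad : ∀ u : E2 → ℝ, ContDiff ℝ 1 u →
      eLpNorm (fun x => bracket x ^ (r + (a + b : ℕ) + 1 / 2) * u x) 4 volume ^ 2 ≤
      C * (eLpNorm (fun x => bracket x ^ (r + (a + b : ℕ)) * u x) 2 volume *
        (eLpNorm (fun x => bracket x ^ (r + (a + b : ℕ)) * u x) 2 volume +
          eLpNorm (fun x => bracket x ^ (r + (a + b : ℕ) + 1) * pdi 0 u x) 2 volume +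
          eLpNorm (fun x => bracket x ^ (r + (a + b : ℕ) + 1) * pdi 1 u x) 2 volume)))
    {h : E2 → ℝ} (hh : ContDiff ℝ (a + b + 1 : ℕ) h) :
    wPiece 4 (r + 1 / 2) a b h ^ 2 ≤
      C * (wPiece 2 r a b h *
        (wPiece 2 r a b h + wPiece 2 r (a + 1) b h + wPiece 2 r a (b + 1) h)) := by
  have hu : ContDiff ℝ 1 (pdMix a b h) :=
    contDiff_pdIter 0 a (m := 1) (contDiff_pdIter 1 b (by convert hh using 2; ring))
  have key := hlad _ hu
  rw [pdi_one_pdMix hh] at key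
  have e1 : r + (a + b : ℕ) + 1 / 2 = r + 1 / 2 + a + b := by push_cast; ring
  have e2 : r + (a + b : ℕ) + 1 = r + (a + 1 : ℕ) + b := by push_cast; ring
  have e3 : r + (a + 1 : ℕ) + b = r + a + (b + 1 : ℕ) := by push_cast; ring
  have e4 : r + (a + b : ℕ) = r + a + b := by push_cast; ring
  rw [e1, e2, e4] at key
  simp only [wPiece]
  rw [← e3]
  exact key

/-- Weighted Gagliardo–Nirenberg-type interpolation:
`‖h‖_{W^{k,4}_{−α₀+1/2}} ≤ C (‖h‖_{H^k_{−α₀}}^{1/3} ‖h‖_{H^{k+1}_{−α₀}}^{2/3} + ‖h‖_{W^{k−1,4}_{−α₀+1/2}})`. -/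
theorem stmt10 (k : ℕ) (hk : 1 ≤ k) :
    ∃ C : ℝ, 0 < C ∧
      ∀ h : E2 → ℝ, ContDiff ℝ (↑(k+1) : ℕ∞) h →
        wFin 4 (-alpha0 + 1/2) k h →
        wFin 2 (-alpha0) k h →
        wFin 2 (-alpha0) (k+1) h →
        wFin 4 (-alpha0 + 1/2) (k-1) h →
        wNorm 4 (-alpha0 + 1/2) k h ≤
          C * ((wNorm 2 (-alpha0) k h) ^ ((1:ℝ)/3) * (wNorm 2 (-alpha0) (k+1) h) ^ ((2:ℝ)/3)
            + wNorm 4 (-alpha0 + 1/2) (k-1) h) := by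
  obtain ⟨C, hC, hlad⟩ := exists_ladyzhenskaya (-alpha0 + k)
  refine ⟨(k + 1) * ((k + 1) * (Real.sqrt (3 * C.toReal) + 1)), by positivity, ?_⟩
  intro h hh _ _ hfin2 _
  set A := wNorm 2 (-alpha0) k h
  set B := wNorm 2 (-alpha0) (k + 1) h
  set N := wNorm 4 (-alpha0 + 1 / 2) (k - 1) h
  have hA : 0 ≤ A := wNorm_nonneg ..
  have hB : 0 ≤ B := wNorm_nonneg ..
  have hN : 0 ≤ N := wNorm_nonneg ..
  have hAB : A ≤ B := wNorm_mono _ _ k.le_succ h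
  set Q := A ^ ((1 : ℝ) / 3) * B ^ ((2 : ℝ) / 3)
  have hQ : 0 ≤ Q := by positivity
  rw [mul_assoc, mul_assoc]
  refine wNorm_le_of_wPiece_le (by positivity) fun a b hab => ?_
  have hS := Real.sqrt_nonneg (3 * C.toReal)
  rcases hab.lt_or_eq with hlt | heq
  · have h1 : (wPiece 4 (-alpha0 + 1 / 2) a b h).toReal ≤ N :=
      wPiece_toReal_le_wNorm _ _ (by omega) h
    nlinarith [mul_nonneg hS (add_nonneg hQ hN)]
  · have h1 : (wPiece 4 (-alpha0 + 1 / 2) a b h).toReal ≤ Real.sqrt (3 * C.toReal) * Q := by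
      refine le_of_sq_le_mul hA hAB (by positivity) ?_
      subst heq
      have hle : (wPiece 2 (-alpha0) a b h).toReal ≤ A := wPiece_toReal_le_wNorm _ _ le_rfl h
      have hB0 : (wPiece 2 (-alpha0) (a + 1) b h).toReal ≤ B :=
        wPiece_toReal_le_wNorm _ _ (by omega) h
      have hB1 : (wPiece 2 (-alpha0) a (b + 1) h).toReal ≤ B :=
        wPiece_toReal_le_wNorm _ _ (by omega) h
      have f0 := hfin2 a b (by omega)
      have f1 := hfin2 (a + 1) b (by omega)
      have f2 := hfin2 a (b + 1) (by omega)
      have hmain := wPiece_sq_le hlad hh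
      have hne : C * (wPiece 2 (-alpha0) a b h * (wPiece 2 (-alpha0) a b h +
          wPiece 2 (-alpha0) (a + 1) b h + wPiece 2 (-alpha0) a (b + 1) h)) ≠ ⊤ := by
        finiteness
      have hreal := ENNReal.toReal_mono hne hmain
      rw [ENNReal.toReal_pow, ENNReal.toReal_mul, ENNReal.toReal_mul,
        ENNReal.toReal_add (by finiteness) f2, ENNReal.toReal_add f0 f1] at hreal
      refine hreal.trans ?_
      calc _ ≤ C.toReal * (A * (B + B + B)) := by
            gcongr
            exact hle.trans hAB
        _ = _ := by ring
    nlinarith [mul_nonneg hS hN]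

end
end

section
/- Let F : ℝ² → ℝ be a C¹ function with compact support and let u : ℝ² → ℝ be C² with |∇u(x)| ≥ 1 for every x in the support of F. Then ∫_{ℝ²} F(x) sin(u(x)/λ) dx → 0 as λ → 0⁺. -/
open MeasureTheory Filter Topology

section NonStationaryPhase

variable {E : Type*} [NormedAddCommGroup E] [NormedSpace ℝ E] [FiniteDimensional ℝ E]
  [MeasurableSpace E] [BorelSpace E] (μ : Measure E) [μ.IsAddHaarMeasure]

/-- Integration by parts in the direction `v` against the oscillating factor `sin (u / lam)`. -/
theorem integral_mul_fderiv_mul_sin_div {G u : E → ℝ} (hG : ContDiff ℝ 1 G)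
    (hGc : HasCompactSupport G) (hu : ContDiff ℝ 1 u) (v : E) {lam : ℝ} (hlam : lam ≠ 0) :
    ∫ x, G x * fderiv ℝ u x v * Real.sin (u x / lam) ∂μ =
      lam * ∫ x, fderiv ℝ G x v * Real.cos (u x / lam) ∂μ := by
  have hud : Differentiable ℝ u := hu.differentiable (by norm_num)
  have hGd : Differentiable ℝ G := hG.differentiable (by norm_num)
  have hcos : ContDiff ℝ 1 fun x => Real.cos (u x / lam) :=
    Real.contDiff_cos.comp (hu.div_const lam)
  have hderiv : ∀ x, fderiv ℝ (fun x => Real.cos (u x / lam)) x v =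
      -(lam⁻¹ * (fderiv ℝ u x v * Real.sin (u x / lam))) := by
    intro x
    have h := ((hud x).hasFDerivAt.mul_const lam⁻¹).cos
    simp only [← div_eq_mul_inv] at h
    rw [h.fderiv]
    simp
    ring
  have hG' : Continuous fun x => fderiv ℝ G x v :=
    (hG.continuous_fderiv (by norm_num)).clm_apply continuous_const
  have hcos' : Continuous fun x => fderiv ℝ (fun x => Real.cos (u x / lam)) x v :=
    (hcos.continuous_fderiv (by norm_num)).clm_apply continuous_const
  have hparts := integral_mul_fderiv_eq_neg_fderiv_mul_of_integrable (μ := μ) (v := v)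
    ((hG'.mul hcos.continuous).integrable_of_hasCompactSupport
      ((hGc.fderiv_apply ℝ v).mul_right))
    ((hG.continuous.mul hcos').integrable_of_hasCompactSupport hGc.mul_right)
    ((hG.continuous.mul hcos.continuous).integrable_of_hasCompactSupport hGc.mul_right)
    (fun x _ => hGd x) (fun x _ => hcos.differentiable (by norm_num) x)
  have hscale : ∀ x, G x * fderiv ℝ u x v * Real.sin (u x / lam) =
      -lam * (G x * fderiv ℝ (fun x => Real.cos (u x / lam)) x v) := by
    intro x
    rw [hderiv]
    field_simp
  simp_rw [hscale]
  rw [integral_const_mul, hparts]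
  ring

theorem tendsto_integral_mul_fderiv_mul_sin_div {G u : E → ℝ} (hG : ContDiff ℝ 1 G)
    (hGc : HasCompactSupport G) (hu : ContDiff ℝ 1 u) (v : E) :
    Tendsto (fun lam : ℝ => ∫ x, G x * fderiv ℝ u x v * Real.sin (u x / lam) ∂μ)
      (𝓝[>] (0 : ℝ)) (𝓝 0) := by
  have hG' : Continuous fun x => fderiv ℝ G x v :=
    (hG.continuous_fderiv (by norm_num)).clm_apply continuous_const
  have hint : Integrable (fun x => fderiv ℝ G x v) μ :=
    hG'.integrable_of_hasCompactSupport (hGc.fderiv_apply ℝ v)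
  have hlim : Tendsto (fun lam : ℝ => lam * ∫ x, ‖fderiv ℝ G x v‖ ∂μ) (𝓝[>] (0 : ℝ)) (𝓝 0) := by
    have h := (continuous_mul_const (∫ x, ‖fderiv ℝ G x v‖ ∂μ)).tendsto (0 : ℝ)
    rw [zero_mul] at h
    exact h.mono_left nhdsWithin_le_nhds
  refine squeeze_zero_norm' ?_ hlim
  filter_upwards [self_mem_nhdsWithin] with lam (hlam : 0 < lam)
  rw [integral_mul_fderiv_mul_sin_div μ hG hGc hu v hlam.ne', norm_mul,
    Real.norm_of_nonneg hlam.le]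
  gcongr
  refine norm_integral_le_of_norm_le hint.norm (ae_of_all _ fun x => ?_)
  rw [norm_mul]
  exact mul_le_of_le_one_right (norm_nonneg _) (Real.abs_cos_le_one _)

/-- Non-stationary phase: the oscillatory integral of a `C¹` amplitude with compact support tends
to zero when the phase is `C²` without critical points on the support. -/
theorem tendsto_integral_mul_sin_div_of_fderiv_ne_zero {F u : E → ℝ} (hF : ContDiff ℝ 1 F)
    (hFc : HasCompactSupport F) (hu : ContDiff ℝ 2 u)
    (hcrit : ∀ x ∈ tsupport F, fderiv ℝ u x ≠ 0) :
    Tendsto (fun lam : ℝ => ∫ x, F x * Real.sin (u x / lam) ∂μ) (𝓝[>] (0 : ℝ)) (𝓝 0) := by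
  let b := Module.finBasis ℝ E
  let S : E → ℝ := fun x => ∑ i, fderiv ℝ u x (b i) ^ 2
  let G := fun i x => F x * (fderiv ℝ u x (b i) / S x)
  have hu1 : ContDiff ℝ 1 u := hu.of_le (by norm_num)
  have hdu : ∀ i, ContDiff ℝ 1 fun x => fderiv ℝ u x (b i) := fun i =>
    (hu.fderiv_right (by norm_num)).clm_apply contDiff_const
  have hS : ContDiff ℝ 1 S := ContDiff.sum fun i _ => (hdu i).pow 2
  have hS0 : ∀ x ∈ tsupport F, S x ≠ 0 := by
    intro x hx h
    rw [Finset.sum_eq_zero_iff_of_nonneg fun i _ => sq_nonneg _] at h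
    refine hcrit x hx (ContinuousLinearMap.coe_injective (b.ext fun i => ?_))
    simpa using h i (Finset.mem_univ i)
  have hGc : ∀ i, HasCompactSupport (G i) := fun i => hFc.mul_right
  have hG : ∀ i, ContDiff ℝ 1 (G i) := by
    refine fun i => contDiff_iff_contDiffAt.2 fun x => ?_
    by_cases hx : x ∈ tsupport F
    · exact hF.contDiffAt.mul ((hdu i).contDiffAt.div hS.contDiffAt (hS0 x hx))
    · refine (contDiffAt_const (c := (0 : ℝ))).congr_of_eventuallyEq ?_
      filter_upwards [notMem_tsupport_iff_eventuallyEq.1 hx] with y hy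
      simp [G, hy]
  have hsum : ∀ x, F x = ∑ i, G i x * fderiv ℝ u x (b i) := by
    intro x
    by_cases hx : x ∈ tsupport F
    · have h : ∑ i, G i x * fderiv ℝ u x (b i) = F x * (S x / S x) := by
        simp only [G, S, Finset.sum_div, Finset.mul_sum]
        exact Finset.sum_congr rfl fun i _ => by ring
      rw [h, div_self (hS0 x hx), mul_one]
    · simp [G, image_eq_zero_of_notMem_tsupport hx]
  have hlim := tendsto_finsetSum Finset.univ fun i _ =>
    tendsto_integral_mul_fderiv_mul_sin_div μ (hG i) (hGc i) hu1 (b i)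
  rw [Finset.sum_const_zero] at hlim
  refine hlim.congr fun lam => ?_
  have hsin : Continuous fun x => Real.sin (u x / lam) :=
    Real.continuous_sin.comp (hu.continuous.div_const lam)
  rw [← integral_finsetSum]
  · simp_rw [← Finset.sum_mul, ← hsum]
  · intro i _
    exact (((hG i).continuous.mul (hdu i).continuous).mul
      hsin).integrable_of_hasCompactSupport ((hGc i).mul_right.mul_right)

end NonStationaryPhase

/-- Non-stationary phase: if `F` is `C¹` with compact support and `u` is `C²` with
`|∇u| ≥ 1` on the support of `F`, then `∫ F sin(u/λ) → 0` as `λ → 0⁺`. -/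
theorem stmt14 (F u : EuclideanSpace ℝ (Fin 2) → ℝ)
    (hF : ContDiff ℝ 1 F) (hFc : HasCompactSupport F)
    (hu : ContDiff ℝ 2 u)
    (hgrad : ∀ x ∈ tsupport F, 1 ≤ ‖fderiv ℝ u x‖) :
    Tendsto (fun lam : ℝ => ∫ x, F x * Real.sin (u x / lam))
      (𝓝[>] (0:ℝ)) (𝓝 0) := by
  exact tendsto_integral_mul_sin_div_of_fderiv_ne_zero volume hF hFc hu fun x hx h => by
    have := hgrad x hx
    rw [h, norm_zero] at this
    linarith
end
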